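/- Assume ∫ (p̃0 + p̃1)(1 + U′(x)^2) dμ < ∞ and that D1 = D_KL(P1‖P0) and D0 = D_KL(P0‖P1) are finite. Let U′(X) be the thermodynamic integration estimator obtained by drawing β uniformly from [0,1] and then X from P_β. Then its variance satisfies Var[U′(X)] ≤ 3 ( D1 + D0 + 2|log(Z1/Z0)| )^2 + ( D1 + D0 + 2|log(Z1/Z0)| ). -/

import Mathlib

open MeasureTheory ProbabilityTheory
open scoped ENNReal

/-- The partition function `Z_β = ∫ p̃₁^β p̃₀^{1-β} dμ` along the geometric path. -/
noncomputable def pathZ {𝒳 : Type*} [MeasurableSpace 𝒳] (μ : Measure 𝒳)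
    (p₀ p₁ : 𝒳 → ℝ) (β : ℝ) : ℝ :=
  ∫ x, p₁ x ^ β * p₀ x ^ (1 - β) ∂μ

/-- The law of the thermodynamic-integration sample: `β ∼ Uniform([0,1])`, `X | β ∼ P_β`. -/
noncomputable def tiLaw {𝒳 : Type*} [MeasurableSpace 𝒳] (μ : Measure 𝒳)
    (p₀ p₁ : 𝒳 → ℝ) : Measure 𝒳 :=
  ((volume : Measure ℝ).restrict (Set.Icc 0 1)).bind
    (fun β => μ.withDensity
      (fun x => ENNReal.ofReal (p₁ x ^ β * p₀ x ^ (1 - β) / pathZ μ p₀ p₁ β)))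

/-- The unnormalised `k`-th moment `∫ U′^k p̃₁^β p̃₀^{1-β} dμ` of `U′ = log (p̃₁ / p̃₀)` along the
geometric path. -/
noncomputable def pathMoment {𝒳 : Type*} [MeasurableSpace 𝒳] (μ : Measure 𝒳)
    (p₀ p₁ : 𝒳 → ℝ) (k : ℕ) (β : ℝ) : ℝ :=
  ∫ x, Real.log (p₁ x / p₀ x) ^ k * (p₁ x ^ β * p₀ x ^ (1 - β)) ∂μ

lemma pathMoment_zero {𝒳 : Type*} [MeasurableSpace 𝒳] (μ : Measure 𝒳) (p₀ p₁ : 𝒳 → ℝ) (β : ℝ) :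
    pathMoment μ p₀ p₁ 0 β = pathZ μ p₀ p₁ β := by
  simp [pathMoment, pathZ]

lemma rpow_mul_rpow_one_sub_eq_exp {a b : ℝ} (ha : 0 < a) (hb : 0 < b) (β : ℝ) :
    b ^ β * a ^ (1 - β) = a * Real.exp (Real.log (b / a) * β) := by
  rw [Real.log_div hb.ne' ha.ne', Real.rpow_def_of_pos hb, Real.rpow_def_of_pos ha,
    ← Real.exp_add]
  nth_rw 2 [← Real.exp_log ha]
  rw [← Real.exp_add]
  congr 1
  ring

lemma rpow_mul_rpow_one_sub_le_add {a b β : ℝ} (ha : 0 < a) (hb : 0 < b)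
    (hβ : β ∈ Set.Icc (0 : ℝ) 1) : b ^ β * a ^ (1 - β) ≤ a + b := by
  have h := Real.geom_mean_le_arith_mean2_weighted hβ.1 (sub_nonneg.2 hβ.2) hb.le ha.le
    (by ring)
  nlinarith [hβ.1, hβ.2]

lemma hasDerivAt_rpow_mul_rpow_one_sub {a b : ℝ} (ha : 0 < a) (hb : 0 < b) (β : ℝ) :
    HasDerivAt (fun β : ℝ => b ^ β * a ^ (1 - β))
      (Real.log (b / a) * (b ^ β * a ^ (1 - β))) β := by
  simp_rw [rpow_mul_rpow_one_sub_eq_exp ha hb]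
  refine ((((hasDerivAt_id' β).const_mul (Real.log (b / a))).exp).const_mul a).congr_deriv ?_
  ring

lemma abs_pow_le_one_add_sq {k : ℕ} (hk : k ≤ 2) (t : ℝ) : |t| ^ k ≤ 1 + t ^ 2 := by
  interval_cases k
  · nlinarith
  · nlinarith [sq_nonneg (|t| - 1), sq_abs t, abs_nonneg t]
  · simp

lemma norm_path_integrand_le {𝒳 : Type*} {p₀ p₁ : 𝒳 → ℝ}
    (hp₀pos : ∀ x, 0 < p₀ x) (hp₁pos : ∀ x, 0 < p₁ x) {k : ℕ} (hk : k ≤ 2)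
    {β : ℝ} (hβ : β ∈ Set.Icc (0 : ℝ) 1) (x : 𝒳) :
    ‖Real.log (p₁ x / p₀ x) ^ k * (p₁ x ^ β * p₀ x ^ (1 - β))‖
      ≤ (p₀ x + p₁ x) * (1 + Real.log (p₁ x / p₀ x) ^ 2) := by
  have h0 := hp₀pos x
  have h1 := hp₁pos x
  have hw : 0 < p₁ x ^ β * p₀ x ^ (1 - β) := by positivity
  rw [norm_mul, norm_pow, Real.norm_eq_abs, Real.norm_eq_abs, abs_of_pos hw, mul_comm]
  exact mul_le_mul (rpow_mul_rpow_one_sub_le_add h0 h1 hβ) (abs_pow_le_one_add_sq hk _)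
    (by positivity) (by positivity)

section GeometricPath

variable {𝒳 : Type*} [MeasurableSpace 𝒳] {μ : Measure 𝒳} {p₀ p₁ : 𝒳 → ℝ}

lemma measurable_path_integrand (hp₀ : Measurable p₀) (hp₁ : Measurable p₁) (k : ℕ) (β : ℝ) :
    Measurable fun x => Real.log (p₁ x / p₀ x) ^ k * (p₁ x ^ β * p₀ x ^ (1 - β)) := by
  fun_prop

lemma integrable_path_integrand (hp₀ : Measurable p₀) (hp₁ : Measurable p₁)
    (hp₀pos : ∀ x, 0 < p₀ x) (hp₁pos : ∀ x, 0 < p₁ x)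
    (hdom : Integrable (fun x => (p₀ x + p₁ x) * (1 + Real.log (p₁ x / p₀ x) ^ 2)) μ)
    {k : ℕ} (hk : k ≤ 2) {β : ℝ} (hβ : β ∈ Set.Icc (0 : ℝ) 1) :
    Integrable (fun x => Real.log (p₁ x / p₀ x) ^ k * (p₁ x ^ β * p₀ x ^ (1 - β))) μ :=
  hdom.mono' (measurable_path_integrand hp₀ hp₁ k β).aestronglyMeasurable
    (.of_forall (norm_path_integrand_le hp₀pos hp₁pos hk hβ))

lemma continuousOn_pathMoment (hp₀ : Measurable p₀) (hp₁ : Measurable p₁)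
    (hp₀pos : ∀ x, 0 < p₀ x) (hp₁pos : ∀ x, 0 < p₁ x)
    (hdom : Integrable (fun x => (p₀ x + p₁ x) * (1 + Real.log (p₁ x / p₀ x) ^ 2)) μ)
    {k : ℕ} (hk : k ≤ 2) : ContinuousOn (pathMoment μ p₀ p₁ k) (Set.Icc 0 1) := by
  refine continuousOn_of_dominated
    (fun β _ => (measurable_path_integrand hp₀ hp₁ k β).aestronglyMeasurable)
    (fun β hβ => .of_forall (norm_path_integrand_le hp₀pos hp₁pos hk hβ)) hdom
    (.of_forall fun x β _ => ?_)
  exact ((hasDerivAt_rpow_mul_rpow_one_sub (hp₀pos x) (hp₁pos x)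
    β).continuousAt.const_mul _).continuousWithinAt

lemma hasDerivAt_pathMoment (hp₀ : Measurable p₀) (hp₁ : Measurable p₁)
    (hp₀pos : ∀ x, 0 < p₀ x) (hp₁pos : ∀ x, 0 < p₁ x)
    (hdom : Integrable (fun x => (p₀ x + p₁ x) * (1 + Real.log (p₁ x / p₀ x) ^ 2)) μ)
    {k : ℕ} (hk : k + 1 ≤ 2) {β : ℝ} (hβ : β ∈ Set.Ioo (0 : ℝ) 1) :
    HasDerivAt (pathMoment μ p₀ p₁ k) (pathMoment μ p₀ p₁ (k + 1) β) β := by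
  refine (hasDerivAt_integral_of_dominated_loc_of_deriv_le
    (F' := fun β x => Real.log (p₁ x / p₀ x) ^ (k + 1) * (p₁ x ^ β * p₀ x ^ (1 - β)))
    (Ioo_mem_nhds hβ.1 hβ.2)
    (.of_forall fun β => (measurable_path_integrand hp₀ hp₁ k β).aestronglyMeasurable)
    (integrable_path_integrand hp₀ hp₁ hp₀pos hp₁pos hdom (by omega)
      (Set.Ioo_subset_Icc_self hβ))
    (measurable_path_integrand hp₀ hp₁ (k + 1) β).aestronglyMeasurable
    (.of_forall fun x t ht =>
      norm_path_integrand_le hp₀pos hp₁pos hk (Set.Ioo_subset_Icc_self ht) x) hdom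
    (.of_forall fun x t _ => ?_)).2
  refine ((hasDerivAt_rpow_mul_rpow_one_sub (hp₀pos x) (hp₁pos x) t).const_mul
    (Real.log (p₁ x / p₀ x) ^ k)).congr_deriv ?_
  ring

lemma pathZ_pos (hp₀ : Measurable p₀) (hp₁ : Measurable p₁)
    (hp₀pos : ∀ x, 0 < p₀ x) (hp₁pos : ∀ x, 0 < p₁ x) [NeZero μ]
    (hdom : Integrable (fun x => (p₀ x + p₁ x) * (1 + Real.log (p₁ x / p₀ x) ^ 2)) μ)
    {β : ℝ} (hβ : β ∈ Set.Icc (0 : ℝ) 1) : 0 < pathZ μ p₀ p₁ β := by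
  have hpos : ∀ x, 0 < p₁ x ^ β * p₀ x ^ (1 - β) := fun x =>
    mul_pos (Real.rpow_pos_of_pos (hp₁pos x) _) (Real.rpow_pos_of_pos (hp₀pos x) _)
  have hi := integrable_path_integrand hp₀ hp₁ hp₀pos hp₁pos hdom (k := 0) (by omega) hβ
  simp only [pow_zero, one_mul] at hi
  refine (integral_pos_iff_support_of_nonneg (fun x => (hpos x).le) hi).2 ?_
  rw [Function.support_eq_univ fun x => (hpos x).ne']
  exact Measure.measure_univ_pos.2 (NeZero.ne μ)

/-- Jensen's inequality for `U′` under `P_β`. -/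
lemma sq_pathMoment_one_div_le (hp₀ : Measurable p₀) (hp₁ : Measurable p₁)
    (hp₀pos : ∀ x, 0 < p₀ x) (hp₁pos : ∀ x, 0 < p₁ x) [NeZero μ]
    (hdom : Integrable (fun x => (p₀ x + p₁ x) * (1 + Real.log (p₁ x / p₀ x) ^ 2)) μ)
    {β : ℝ} (hβ : β ∈ Set.Icc (0 : ℝ) 1) :
    (pathMoment μ p₀ p₁ 1 β / pathZ μ p₀ p₁ β) ^ 2
      ≤ pathMoment μ p₀ p₁ 2 β / pathZ μ p₀ p₁ β := by
  have hZ := pathZ_pos hp₀ hp₁ hp₀pos hp₁pos hdom hβ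
  have hi := fun k (hk : k ≤ 2) =>
    integrable_path_integrand hp₀ hp₁ hp₀pos hp₁pos hdom hk hβ
  set c := pathMoment μ p₀ p₁ 1 β / pathZ μ p₀ p₁ β with hc
  have hM1 : pathMoment μ p₀ p₁ 1 β = c * pathZ μ p₀ p₁ β := by rw [hc]; field_simp
  have hnn : 0 ≤ ∫ x, (Real.log (p₁ x / p₀ x) - c) ^ 2 * (p₁ x ^ β * p₀ x ^ (1 - β)) ∂μ :=
    integral_nonneg fun x => mul_nonneg (sq_nonneg _)
      (mul_nonneg (Real.rpow_nonneg (hp₁pos x).le _) (Real.rpow_nonneg (hp₀pos x).le _))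
  have heq : ∫ x, (Real.log (p₁ x / p₀ x) - c) ^ 2 * (p₁ x ^ β * p₀ x ^ (1 - β)) ∂μ
      = pathMoment μ p₀ p₁ 2 β - 2 * c * pathMoment μ p₀ p₁ 1 β
        + c ^ 2 * pathMoment μ p₀ p₁ 0 β := by
    simp only [pathMoment]
    rw [← integral_const_mul, ← integral_const_mul,
      ← integral_sub (hi 2 le_rfl) ((hi 1 (by omega)).const_mul _),
      ← integral_add (by exact (hi 2 le_rfl).sub ((hi 1 (by omega)).const_mul _))
        ((hi 0 (by omega)).const_mul _)]
    congr 1 with x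
    simp only [pow_zero, pow_one]
    ring
  rw [heq, hM1, pathMoment_zero] at hnn
  rw [le_div_iff₀ hZ]
  nlinarith

lemma continuousOn_pathMoment_div_pathZ (hp₀ : Measurable p₀) (hp₁ : Measurable p₁)
    (hp₀pos : ∀ x, 0 < p₀ x) (hp₁pos : ∀ x, 0 < p₁ x) [NeZero μ]
    (hdom : Integrable (fun x => (p₀ x + p₁ x) * (1 + Real.log (p₁ x / p₀ x) ^ 2)) μ)
    {k : ℕ} (hk : k ≤ 2) :
    ContinuousOn (fun β => pathMoment μ p₀ p₁ k β / pathZ μ p₀ p₁ β) (Set.Icc 0 1) := by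
  have h0 := continuousOn_pathMoment hp₀ hp₁ hp₀pos hp₁pos hdom (k := 0) (by omega)
  refine (continuousOn_pathMoment hp₀ hp₁ hp₀pos hp₁pos hdom hk).div
    (h0.congr fun β _ => (pathMoment_zero μ p₀ p₁ β).symm)
    fun β hβ => (pathZ_pos hp₀ hp₁ hp₀pos hp₁pos hdom hβ).ne'

lemma hasDerivAt_pathMoment_one_div_pathZ (hp₀ : Measurable p₀) (hp₁ : Measurable p₁)
    (hp₀pos : ∀ x, 0 < p₀ x) (hp₁pos : ∀ x, 0 < p₁ x) [NeZero μ]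
    (hdom : Integrable (fun x => (p₀ x + p₁ x) * (1 + Real.log (p₁ x / p₀ x) ^ 2)) μ)
    {β : ℝ} (hβ : β ∈ Set.Ioo (0 : ℝ) 1) :
    HasDerivAt (fun β => pathMoment μ p₀ p₁ 1 β / pathZ μ p₀ p₁ β)
      (pathMoment μ p₀ p₁ 2 β / pathZ μ p₀ p₁ β
        - (pathMoment μ p₀ p₁ 1 β / pathZ μ p₀ p₁ β) ^ 2) β := by
  have hZ := pathZ_pos hp₀ hp₁ hp₀pos hp₁pos hdom (Set.Ioo_subset_Icc_self hβ)
  have h0 := hasDerivAt_pathMoment hp₀ hp₁ hp₀pos hp₁pos hdom (k := 0) (by omega) hβ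
  have h1 := hasDerivAt_pathMoment hp₀ hp₁ hp₀pos hp₁pos hdom (k := 1) (by omega) hβ
  rw [funext (pathMoment_zero μ p₀ p₁)] at h0
  refine (h1.div h0 hZ.ne').congr_deriv ?_
  field_simp

lemma monotoneOn_pathMoment_one_div_pathZ (hp₀ : Measurable p₀) (hp₁ : Measurable p₁)
    (hp₀pos : ∀ x, 0 < p₀ x) (hp₁pos : ∀ x, 0 < p₁ x) [NeZero μ]
    (hdom : Integrable (fun x => (p₀ x + p₁ x) * (1 + Real.log (p₁ x / p₀ x) ^ 2)) μ) :
    MonotoneOn (fun β => pathMoment μ p₀ p₁ 1 β / pathZ μ p₀ p₁ β) (Set.Icc 0 1) := by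
  refine monotoneOn_of_hasDerivWithinAt_nonneg (convex_Icc 0 1)
    (continuousOn_pathMoment_div_pathZ hp₀ hp₁ hp₀pos hp₁pos hdom (by omega))
    (f' := fun β => pathMoment μ p₀ p₁ 2 β / pathZ μ p₀ p₁ β
        - (pathMoment μ p₀ p₁ 1 β / pathZ μ p₀ p₁ β) ^ 2) ?_ ?_
  · intro β hβ
    rw [interior_Icc] at hβ
    exact (hasDerivAt_pathMoment_one_div_pathZ hp₀ hp₁ hp₀pos hp₁pos hdom hβ).hasDerivWithinAt
  · intro β hβ
    exact sub_nonneg.2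
      (sq_pathMoment_one_div_le hp₀ hp₁ hp₀pos hp₁pos hdom (interior_subset hβ))

lemma exists_pathMoment_one_div_pathZ_eq_log (hp₀ : Measurable p₀) (hp₁ : Measurable p₁)
    (hp₀pos : ∀ x, 0 < p₀ x) (hp₁pos : ∀ x, 0 < p₁ x) [NeZero μ]
    (hdom : Integrable (fun x => (p₀ x + p₁ x) * (1 + Real.log (p₁ x / p₀ x) ^ 2)) μ) :
    ∃ β ∈ Set.Ioo (0 : ℝ) 1, pathMoment μ p₀ p₁ 1 β / pathZ μ p₀ p₁ β
      = Real.log (pathZ μ p₀ p₁ 1 / pathZ μ p₀ p₁ 0) := by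
  have hZ := fun β hβ => pathZ_pos hp₀ hp₁ hp₀pos hp₁pos hdom (β := β) hβ
  have hc := continuousOn_pathMoment hp₀ hp₁ hp₀pos hp₁pos hdom (k := 0) (by omega)
  have hd := fun β hβ => hasDerivAt_pathMoment hp₀ hp₁ hp₀pos hp₁pos hdom (k := 0) (β := β)
    (by omega) hβ
  rw [funext (pathMoment_zero μ p₀ p₁)] at hc hd
  obtain ⟨β, hβ, h⟩ := exists_hasDerivAt_eq_slope (fun β => Real.log (pathZ μ p₀ p₁ β))
    (fun β => pathMoment μ p₀ p₁ 1 β / pathZ μ p₀ p₁ β) zero_lt_one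
    (hc.log fun β hβ => (hZ β hβ).ne')
    fun β hβ => (hd β hβ).log (hZ β (Set.Ioo_subset_Icc_self hβ)).ne'
  refine ⟨β, hβ, ?_⟩
  rw [h, Real.log_div (hZ 1 (by simp)).ne' (hZ 0 (by simp)).ne']
  simp

/-- `∫₀¹ E_β[U′^2] dβ = E_1[U′] - E_0[U′] + ∫₀¹ E_β[U′]^2 dβ`. -/
lemma integral_pathMoment_two_div_pathZ (hp₀ : Measurable p₀) (hp₁ : Measurable p₁)
    (hp₀pos : ∀ x, 0 < p₀ x) (hp₁pos : ∀ x, 0 < p₁ x) [NeZero μ]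
    (hdom : Integrable (fun x => (p₀ x + p₁ x) * (1 + Real.log (p₁ x / p₀ x) ^ 2)) μ) :
    ∫ β in (0 : ℝ)..1, pathMoment μ p₀ p₁ 2 β / pathZ μ p₀ p₁ β
      = pathMoment μ p₀ p₁ 1 1 / pathZ μ p₀ p₁ 1 - pathMoment μ p₀ p₁ 1 0 / pathZ μ p₀ p₁ 0
        + ∫ β in (0 : ℝ)..1, (pathMoment μ p₀ p₁ 1 β / pathZ μ p₀ p₁ β) ^ 2 := by
  have hc := fun k (hk : k ≤ 2) =>
    continuousOn_pathMoment_div_pathZ hp₀ hp₁ hp₀pos hp₁pos hdom hk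
  have h2 : IntervalIntegrable (fun β => pathMoment μ p₀ p₁ 2 β / pathZ μ p₀ p₁ β)
      volume 0 1 := (hc 2 le_rfl).intervalIntegrable_of_Icc zero_le_one
  have h1 : IntervalIntegrable (fun β => (pathMoment μ p₀ p₁ 1 β / pathZ μ p₀ p₁ β) ^ 2)
      volume 0 1 := ((hc 1 (by omega)).pow 2).intervalIntegrable_of_Icc zero_le_one
  have h := intervalIntegral.integral_eq_sub_of_hasDerivAt_of_le zero_le_one (hc 1 (by omega))
    (fun β hβ => hasDerivAt_pathMoment_one_div_pathZ hp₀ hp₁ hp₀pos hp₁pos hdom hβ)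
    (h2.sub h1)
  rw [intervalIntegral.integral_sub h2 h1] at h
  linarith

lemma measurable_path_density [SFinite μ] (hp₀ : Measurable p₀) (hp₁ : Measurable p₁) :
    Measurable fun z : ℝ × 𝒳 =>
      ENNReal.ofReal (p₁ z.2 ^ z.1 * p₀ z.2 ^ (1 - z.1) / pathZ μ p₀ p₁ z.1) := by
  have hw : Measurable fun z : ℝ × 𝒳 => p₁ z.2 ^ z.1 * p₀ z.2 ^ (1 - z.1) := by fun_prop
  have hZ : Measurable (pathZ μ p₀ p₁) :=
    (hw.stronglyMeasurable.integral_prod_right (ν := μ)).measurable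
  exact (hw.div (hZ.comp measurable_fst)).ennreal_ofReal

lemma measurable_path_withDensity [SFinite μ] (hp₀ : Measurable p₀) (hp₁ : Measurable p₁) :
    Measurable fun β : ℝ => μ.withDensity
      (fun x => ENNReal.ofReal (p₁ x ^ β * p₀ x ^ (1 - β) / pathZ μ p₀ p₁ β)) := by
  refine Measure.measurable_of_measurable_coe _ fun s hs => ?_
  simp_rw [withDensity_apply _ hs]
  exact (measurable_path_density hp₀ hp₁).lintegral_prod_right'

lemma lintegral_path_withDensity_log_pow (hp₀ : Measurable p₀) (hp₁ : Measurable p₁)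
    (hp₀pos : ∀ x, 0 < p₀ x) (hp₁pos : ∀ x, 0 < p₁ x) [NeZero μ] [SFinite μ]
    (hdom : Integrable (fun x => (p₀ x + p₁ x) * (1 + Real.log (p₁ x / p₀ x) ^ 2)) μ)
    {k : ℕ} (hk : k ≤ 2) (hk_even : Even k) {β : ℝ} (hβ : β ∈ Set.Icc (0 : ℝ) 1) :
    ∫⁻ x, ENNReal.ofReal (Real.log (p₁ x / p₀ x) ^ k) ∂(μ.withDensity
      (fun x => ENNReal.ofReal (p₁ x ^ β * p₀ x ^ (1 - β) / pathZ μ p₀ p₁ β)))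
      = ENNReal.ofReal (pathMoment μ p₀ p₁ k β / pathZ μ p₀ p₁ β) := by
  have hZ := pathZ_pos hp₀ hp₁ hp₀pos hp₁pos hdom hβ
  have hw : ∀ x, 0 ≤ p₁ x ^ β * p₀ x ^ (1 - β) := fun x =>
    mul_nonneg (Real.rpow_nonneg (hp₁pos x).le _) (Real.rpow_nonneg (hp₀pos x).le _)
  rw [lintegral_withDensity_eq_lintegral_mul _ (by fun_prop) (by fun_prop), pathMoment,
    ← integral_div, ofReal_integral_eq_lintegral_ofReal
      ((integrable_path_integrand hp₀ hp₁ hp₀pos hp₁pos hdom hk hβ).div_const _)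
      (.of_forall fun x => div_nonneg (mul_nonneg (hk_even.pow_nonneg _) (hw x)) hZ.le)]
  congr 1 with x
  rw [Pi.mul_apply, ← ENNReal.ofReal_mul (div_nonneg (hw x) hZ.le)]
  congr 1
  ring

lemma isProbabilityMeasure_tiLaw (hp₀ : Measurable p₀) (hp₁ : Measurable p₁)
    (hp₀pos : ∀ x, 0 < p₀ x) (hp₁pos : ∀ x, 0 < p₁ x) [NeZero μ] [SFinite μ]
    (hdom : Integrable (fun x => (p₀ x + p₁ x) * (1 + Real.log (p₁ x / p₀ x) ^ 2)) μ) :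
    IsProbabilityMeasure (tiLaw μ p₀ p₁) := by
  have : IsProbabilityMeasure ((volume : Measure ℝ).restrict (Set.Icc 0 1)) := ⟨by simp⟩
  refine isProbabilityMeasure_bind (measurable_path_withDensity hp₀ hp₁).aemeasurable ?_
  filter_upwards [ae_restrict_mem measurableSet_Icc] with β hβ
  have h := lintegral_path_withDensity_log_pow hp₀ hp₁ hp₀pos hp₁pos hdom (Nat.zero_le 2)
    Even.zero hβ
  rw [pathMoment_zero, div_self (pathZ_pos hp₀ hp₁ hp₀pos hp₁pos hdom hβ).ne'] at h
  exact ⟨by simpa using h⟩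

lemma integral_log_sq_tiLaw (hp₀ : Measurable p₀) (hp₁ : Measurable p₁)
    (hp₀pos : ∀ x, 0 < p₀ x) (hp₁pos : ∀ x, 0 < p₁ x) [NeZero μ] [SFinite μ]
    (hdom : Integrable (fun x => (p₀ x + p₁ x) * (1 + Real.log (p₁ x / p₀ x) ^ 2)) μ) :
    ∫ x, Real.log (p₁ x / p₀ x) ^ 2 ∂(tiLaw μ p₀ p₁)
      = ∫ β in (0 : ℝ)..1, pathMoment μ p₀ p₁ 2 β / pathZ μ p₀ p₁ β := by
  have hm : Measurable fun x => Real.log (p₁ x / p₀ x) ^ 2 := by fun_prop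
  have hnn : ∀ β ∈ Set.Icc (0 : ℝ) 1, 0 ≤ pathMoment μ p₀ p₁ 2 β / pathZ μ p₀ p₁ β :=
    fun β hβ => (sq_nonneg _).trans
      (sq_pathMoment_one_div_le hp₀ hp₁ hp₀pos hp₁pos hdom hβ)
  have hc := continuousOn_pathMoment_div_pathZ hp₀ hp₁ hp₀pos hp₁pos hdom le_rfl
  rw [integral_eq_lintegral_of_nonneg_ae (.of_forall fun x => sq_nonneg _)
      hm.aestronglyMeasurable, tiLaw,
    Measure.lintegral_bind (measurable_path_withDensity hp₀ hp₁).aemeasurable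
      hm.ennreal_ofReal.aemeasurable,
    setLIntegral_congr_fun measurableSet_Icc fun β hβ =>
      lintegral_path_withDensity_log_pow hp₀ hp₁ hp₀pos hp₁pos hdom le_rfl even_two hβ,
    ← ofReal_integral_eq_lintegral_ofReal (hc.integrableOn_Icc)
      ((ae_restrict_mem measurableSet_Icc).mono hnn),
    ENNReal.toReal_ofReal (setIntegral_nonneg measurableSet_Icc hnn),
    integral_Icc_eq_integral_Ioc, intervalIntegral.integral_of_le zero_le_one]

end GeometricPath

/-- The Kullback–Leibler integral of normalised densities, in terms of the unnormalised ones. -/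
lemma integral_div_mul_log_div {𝒳 : Type*} [MeasurableSpace 𝒳] {μ : Measure 𝒳} {p q : 𝒳 → ℝ}
    (hp : ∀ x, 0 < p x) (hq : ∀ x, 0 < q x) (hpi : Integrable p μ)
    (hpq : Integrable (fun x => Real.log (p x / q x) * p x) μ) {a b : ℝ}
    (ha : a = ∫ x, p x ∂μ) (ha_pos : 0 < a) (hb_pos : 0 < b) :
    ∫ x, (p x / a) * Real.log ((p x / a) / (q x / b)) ∂μ
      = (∫ x, Real.log (p x / q x) * p x ∂μ) / a - Real.log (a / b) := by
  have h : ∀ x, (p x / a) * Real.log ((p x / a) / (q x / b))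
      = Real.log (p x / q x) * p x / a - Real.log (a / b) / a * p x := fun x => by
    rw [div_div_div_comm, Real.log_div (div_pos (hp x) (hq x)).ne' (div_pos ha_pos hb_pos).ne']
    ring
  simp_rw [h]
  rw [integral_sub (hpq.div_const a) (hpi.const_mul _), integral_div, integral_const_mul, ← ha]
  field_simp

/-- **Variance bound for the thermodynamic integration estimator.**
For the estimator `U′(X)` obtained by drawing `β ∼ Uniform([0,1])` and then `X ∼ P_β`,
`Var[U′(X)] ≤ 3 (D₁ + D₀ + 2 |log (Z₁/Z₀)|)² + (D₁ + D₀ + 2 |log (Z₁/Z₀)|)`. -/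
theorem ti_estimator_variance_bound
    {𝒳 : Type*} [MeasurableSpace 𝒳] (μ : Measure 𝒳) [SigmaFinite μ]
    (p₀ p₁ : 𝒳 → ℝ) (hp₀ : Measurable p₀) (hp₁ : Measurable p₁)
    (hp₀pos : ∀ x, 0 < p₀ x) (hp₁pos : ∀ x, 0 < p₁ x)
    (hint₀ : Integrable p₀ μ) (hint₁ : Integrable p₁ μ)
    (Z₀ Z₁ : ℝ) (hZ₀ : Z₀ = ∫ x, p₀ x ∂μ) (hZ₁ : Z₁ = ∫ x, p₁ x ∂μ)
    (hZ₀pos : 0 < Z₀) (hZ₁pos : 0 < Z₁)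
    (hdom : Integrable (fun x => (p₀ x + p₁ x) * (1 + Real.log (p₁ x / p₀ x) ^ 2)) μ)
    -- finiteness of the two Kullback–Leibler divergences
    (D₁ D₀ : ℝ)
    (hD₁ : D₁ = ∫ x, (p₁ x / Z₁) * Real.log ((p₁ x / Z₁) / (p₀ x / Z₀)) ∂μ)
    (hD₁int : Integrable (fun x => (p₁ x / Z₁) * Real.log ((p₁ x / Z₁) / (p₀ x / Z₀))) μ)
    (hD₀ : D₀ = ∫ x, (p₀ x / Z₀) * Real.log ((p₀ x / Z₀) / (p₁ x / Z₁)) ∂μ)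
    (hD₀int : Integrable (fun x => (p₀ x / Z₀) * Real.log ((p₀ x / Z₀) / (p₁ x / Z₁))) μ) :
    variance (fun x => Real.log (p₁ x / p₀ x)) (tiLaw μ p₀ p₁)
      ≤ 3 * (D₁ + D₀ + 2 * |Real.log (Z₁ / Z₀)|) ^ 2
        + (D₁ + D₀ + 2 * |Real.log (Z₁ / Z₀)|) := by
  have : NeZero μ := ⟨by
    rintro rfl
    simp [hZ₀] at hZ₀pos⟩
  have := isProbabilityMeasure_tiLaw hp₀ hp₁ hp₀pos hp₁pos hdom
  have hz₀ : pathZ μ p₀ p₁ 0 = Z₀ := by simp [pathZ, hZ₀]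
  have hz₁ : pathZ μ p₀ p₁ 1 = Z₁ := by simp [pathZ, hZ₁]
  have hi₀ := integrable_path_integrand hp₀ hp₁ hp₀pos hp₁pos hdom (k := 1) (β := 0)
    (by omega) (by simp)
  have hi₁ := integrable_path_integrand hp₀ hp₁ hp₀pos hp₁pos hdom (k := 1) (β := 1)
    (by omega) (by simp)
  simp only [pow_one, Real.rpow_zero, sub_zero, Real.rpow_one, one_mul, sub_self, mul_one]
    at hi₀ hi₁
  set L := Real.log (Z₁ / Z₀) with hL
  have hflip : ∀ x, Real.log (p₀ x / p₁ x) * p₀ x = -(Real.log (p₁ x / p₀ x) * p₀ x) :=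
    fun x => by rw [← inv_div, Real.log_inv, neg_mul]
  have hE₁ : pathMoment μ p₀ p₁ 1 1 / pathZ μ p₀ p₁ 1 = D₁ + L := by
    rw [hD₁, integral_div_mul_log_div hp₁pos hp₀pos hint₁ hi₁ hZ₁ hZ₁pos hZ₀pos, hz₁]
    simp [pathMoment, hL]
  have hE₀ : pathMoment μ p₀ p₁ 1 0 / pathZ μ p₀ p₁ 0 = L - D₀ := by
    rw [hD₀, integral_div_mul_log_div hp₀pos hp₁pos hint₀
      (hi₀.neg.congr (.of_forall fun x => (hflip x).symm)) hZ₀ hZ₀pos hZ₁pos, hz₀]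
    simp_rw [hflip]
    rw [integral_neg, ← inv_div Z₁ Z₀, Real.log_inv]
    simp only [pathMoment, pow_one, Real.rpow_zero, sub_zero, Real.rpow_one, one_mul, ← hL]
    ring
  have hmono := monotoneOn_pathMoment_one_div_pathZ hp₀ hp₁ hp₀pos hp₁pos hdom
  have hbounds : ∀ β ∈ Set.Icc (0 : ℝ) 1,
      L - D₀ ≤ pathMoment μ p₀ p₁ 1 β / pathZ μ p₀ p₁ β ∧
        pathMoment μ p₀ p₁ 1 β / pathZ μ p₀ p₁ β ≤ D₁ + L := fun β hβ =>
    ⟨hE₀ ▸ hmono (by simp) hβ hβ.1, hE₁ ▸ hmono hβ (by simp) hβ.2⟩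
  obtain ⟨β, hβ, hβL⟩ := exists_pathMoment_one_div_pathZ_eq_log hp₀ hp₁ hp₀pos hp₁pos hdom
  rw [hz₀, hz₁, ← hL] at hβL
  have hLb := hbounds β (Set.Ioo_subset_Icc_self hβ)
  rw [hβL] at hLb
  set A := D₁ + D₀ + 2 * |L| with hA
  have hsq : ∫ β in (0 : ℝ)..1, (pathMoment μ p₀ p₁ 1 β / pathZ μ p₀ p₁ β) ^ 2 ≤ A ^ 2 := by
    have hcont := (continuousOn_pathMoment_div_pathZ hp₀ hp₁ hp₀pos hp₁pos hdom
      (k := 1) (by omega)).pow 2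
    have h := intervalIntegral.integral_mono_on (μ := volume) (g := fun _ => A ^ 2) zero_le_one
      (hcont.intervalIntegrable_of_Icc zero_le_one) intervalIntegrable_const fun t ht => ?_
    · simpa using h
    · have ht := hbounds t ht
      refine sq_le_sq' ?_ ?_ <;> linarith [neg_abs_le L, le_abs_self L, ht.1, ht.2]
  calc variance (fun x => Real.log (p₁ x / p₀ x)) (tiLaw μ p₀ p₁)
      ≤ ∫ x, Real.log (p₁ x / p₀ x) ^ 2 ∂(tiLaw μ p₀ p₁) :=
        variance_le_expectation_sq
          (hp₁.div hp₀).log.aestronglyMeasurable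
    _ ≤ 3 * A ^ 2 + A := by
        rw [integral_log_sq_tiLaw hp₀ hp₁ hp₀pos hp₁pos hdom,
          integral_pathMoment_two_div_pathZ hp₀ hp₁ hp₀pos hp₁pos hdom, hE₁, hE₀]
        linarith [abs_nonneg L, sq_nonneg A]
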